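/- Assume α, β, γ are positive irrational numbers with α + β + γ = 1, β < 1/2 and α < γ, and assume in addition that 1, α, β are linearly independent over ℚ. With W̃_β, W̃_γ as defined in the context, the limit Ω = lim_{N→∞} (1/N) Σ_{n≤N} [ (W̃_β(n) − W_β(n))² + (W̃_γ(n) − W_γ(n))² ] exists and Ω = 1/4. -/

import Mathlib

open Filter

/-- The `n`-th term of the Webster sequence of density `d`: `⌈(n - 1/2)/d⌉`. -/
noncomputable def wTerm (d : ℝ) (n : ℕ) : ℕ := ⌈((n : ℝ) - 1/2) / d⌉₊

/-- The Webster sequence of density `d`, as a set of positive integers. -/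
def wSet (d : ℝ) : Set ℕ := {m : ℕ | ∃ n : ℕ, 1 ≤ n ∧ m = wTerm d n}

/-- Counting function of a set of positive integers: `S(m) = #{k ∈ S : k ≤ m}`. -/
noncomputable def wCount (S : Set ℕ) (m : ℕ) : ℕ := (S ∩ Set.Iic m).ncard

/-- `u_n = {nd + 1/2}` (fractional part), for density `d`. -/
noncomputable def fpart (d : ℝ) (n : ℕ) : ℝ := Int.fract ((n : ℝ) * d + 1/2)

/-- The set `W̃_α` of Algorithm 2. -/
def WtA (α : ℝ) : Set ℕ := {n : ℕ | 1 ≤ n ∧ fpart α n < α}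

/-- The set `W̃_β` of Algorithm 2. -/
def WtB (α β : ℝ) : Set ℕ := {n : ℕ | 1 ≤ n ∧
  ((α < fpart α n ∧ fpart β n < β) ∨
   (1 - α < fpart α n ∧ 1 - β/2 < fpart β n) ∨
   (α < fpart α n ∧ fpart α n < 2*α ∧ β < fpart β n ∧ fpart β n < 3*β/2))}

/-- The set `W̃_γ` of Algorithm 2. -/
def WtC (α β : ℝ) : Set ℕ := {n : ℕ | 1 ≤ n} \ (WtA α ∪ WtB α β)

theorem tendsto_apply_of_span_dense {V : Type*} [NormedAddCommGroup V] [NormedSpace ℂ V]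
    (T : ℕ → V →ₗ[ℂ] ℂ) (L : V →ₗ[ℂ] ℂ) {C : ℝ} (hC : 0 ≤ C)
    (hT : ∀ N v, ‖T N v‖ ≤ C * ‖v‖) (hL : ∀ v, ‖L v‖ ≤ C * ‖v‖) {s : Set V}
    (hs : (Submodule.span ℂ s).topologicalClosure = ⊤)
    (h : ∀ v ∈ s, Tendsto (fun N => T N v) atTop (nhds (L v))) (v : V) :
    Tendsto (fun N => T N v) atTop (nhds (L v)) := by
  have hspan : ∀ w ∈ Submodule.span ℂ s, Tendsto (fun N => T N w) atTop (nhds (L w)) := by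
    intro w hw
    induction hw using Submodule.span_induction with
    | mem x hx => exact h x hx
    | zero => simp
    | add x y _ _ hx hy => simpa using hx.add hy
    | smul a x _ hx => simpa using hx.const_mul a
  rw [Metric.tendsto_atTop]
  intro ε hε
  have hv : v ∈ closure (Submodule.span ℂ s : Set V) := by
    rw [← Submodule.topologicalClosure_coe, hs]; trivial
  obtain ⟨w, hw, hvw⟩ := Metric.mem_closure_iff.mp hv (ε / (3 * (C + 1))) (by positivity)
  obtain ⟨N₀, hN₀⟩ := Metric.tendsto_atTop.mp (hspan w hw) (ε / 3) (by positivity)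
  refine ⟨N₀, fun N hN => ?_⟩
  have hsmall : C * ‖v - w‖ ≤ ε / 3 := by
    rw [dist_eq_norm, lt_div_iff₀ (by positivity)] at hvw
    nlinarith [norm_nonneg (v - w)]
  have h1 : dist (T N v) (T N w) ≤ ε / 3 := by
    rw [dist_eq_norm, ← map_sub]; exact (hT N _).trans hsmall
  have h2 : dist (L w) (L v) ≤ ε / 3 := by
    rw [dist_comm, dist_eq_norm, ← map_sub]; exact (hL _).trans hsmall
  have h3 := hN₀ N hN
  linarith [dist_triangle4 (T N v) (T N w) (L w) (L v)]

theorem tendsto_average_mul_pow {z : ℂ} (c : ℂ) (hz : ‖z‖ = 1) (hz1 : z ≠ 1) :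
    Tendsto (fun N : ℕ => (N : ℂ)⁻¹ * ∑ n ∈ Finset.Icc 1 N, c * z ^ n) atTop (nhds 0) := by
  have hsub : 0 < ‖z - 1‖ := norm_pos_iff.mpr (sub_ne_zero.mpr hz1)
  have hbound : ∀ N : ℕ, ‖(N : ℂ)⁻¹ * ∑ n ∈ Finset.Icc 1 N, c * z ^ n‖
      ≤ (N : ℝ)⁻¹ * (‖c‖ * (2 / ‖z - 1‖)) := by
    intro N
    have hsum : ∑ n ∈ Finset.Icc 1 N, c * z ^ n = c * (z * ((z ^ N - 1) / (z - 1))) := by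
      rw [← Finset.mul_sum, ← Finset.Ico_add_one_right_eq_Icc, geom_sum_Ico hz1 (by omega)]
      ring
    rw [hsum, norm_mul, norm_inv, Complex.norm_natCast, norm_mul, norm_mul, hz, norm_div, one_mul]
    have : ‖z ^ N - 1‖ ≤ 2 := by
      refine (norm_sub_le _ _).trans ?_
      rw [norm_pow, hz]; norm_num
    gcongr
  refine squeeze_zero_norm hbound ?_
  simpa using (tendsto_inv_atTop_nhds_zero_nat (𝕜 := ℝ)).mul_const (‖c‖ * (2 / ‖z - 1‖))

open AddCircle MeasureTheory in
theorem integral_fourier_haarAddCircle (k : ℤ) :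
    ∫ x : UnitAddCircle, fourier k x ∂haarAddCircle = if k = 0 then 1 else 0 := by
  split_ifs with hk
  · subst hk; simp
  · exact integral_eq_zero_of_add_right_eq_neg (fourier_add_half_inv_index hk one_pos)

/-- Integration against the Haar probability measure of the circle, as a linear functional. -/
noncomputable def haarIntegral : C(UnitAddCircle, ℂ) →ₗ[ℂ] ℂ where
  toFun f := ∫ x, f x ∂AddCircle.haarAddCircle
  map_add' f g := by
    exact MeasureTheory.integral_add
      (f.continuous.integrable_of_hasCompactSupport (HasCompactSupport.of_compactSpace _))
      (g.continuous.integrable_of_hasCompactSupport (HasCompactSupport.of_compactSpace _))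
  map_smul' c f := by
    simpa using MeasureTheory.integral_const_mul c (fun x => f x)

theorem norm_haarIntegral_le (f : C(UnitAddCircle, ℂ)) : ‖haarIntegral f‖ ≤ ‖f‖ := by
  simpa [haarIntegral] using MeasureTheory.norm_integral_le_of_norm_le_const
    (μ := AddCircle.haarAddCircle) (Eventually.of_forall fun x => f.norm_coe_le_norm x)

/-- The average over `1 ≤ n ≤ N` of the values at `x n`, weighted by `w n`. -/
noncomputable def weightedAverage (x : ℕ → UnitAddCircle) (w : ℕ → ℂ) (N : ℕ) :
    C(UnitAddCircle, ℂ) →ₗ[ℂ] ℂ where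
  toFun f := (N : ℂ)⁻¹ * ∑ n ∈ Finset.Icc 1 N, f (x n) * w n
  map_add' f g := by
    simp [add_mul, Finset.sum_add_distrib, mul_add]
  map_smul' c f := by
    simp only [ContinuousMap.smul_apply, smul_eq_mul, RingHom.id_apply, mul_assoc,
      ← Finset.mul_sum]
    ring

theorem norm_weightedAverage_le {x : ℕ → UnitAddCircle} {w : ℕ → ℂ} {C : ℝ} (hC : 0 ≤ C)
    (hw : ∀ n, ‖w n‖ ≤ C) (N : ℕ) (f : C(UnitAddCircle, ℂ)) :
    ‖weightedAverage x w N f‖ ≤ C * ‖f‖ := by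
  have hsum : ‖∑ n ∈ Finset.Icc 1 N, f (x n) * w n‖ ≤ N * (C * ‖f‖) := by
    refine (norm_sum_le_of_le (f := fun n => f (x n) * w n) _ (fun n _ => ?_)).trans
      (b := ∑ n ∈ Finset.Icc 1 N, C * ‖f‖) ?_
    · rw [norm_mul, mul_comm]
      exact mul_le_mul (hw n) (f.norm_coe_le_norm _) (norm_nonneg _) hC
    · simp
  simp only [weightedAverage, LinearMap.coe_mk, AddHom.coe_mk, norm_mul, norm_inv,
    Complex.norm_natCast]
  rcases N.eq_zero_or_pos with rfl | hN
  · simp; positivity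
  · rw [inv_mul_le_iff₀ (by positivity)]; exact hsum

/-- Weyl's theorem for products of continuous functions along a generic rotation of the
two-dimensional torus. -/
theorem tendsto_average_mul_continuousMap {a b : ℝ} (s t : ℝ)
    (hab : ∀ j k m : ℤ, (j : ℝ) * a + k * b = m → j = 0 ∧ k = 0) (f g : C(UnitAddCircle, ℂ)) :
    Tendsto (fun N : ℕ => (N : ℂ)⁻¹ * ∑ n ∈ Finset.Icc 1 N,
        f ((n * a + s : ℝ) : UnitAddCircle) * g ((n * b + t : ℝ) : UnitAddCircle))
      atTop (nhds (haarIntegral f * haarIntegral g)) := by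
  have hchar : ∀ j k : ℤ, Tendsto (fun N : ℕ => (N : ℂ)⁻¹ * ∑ n ∈ Finset.Icc 1 N,
        fourier j ((n * a + s : ℝ) : UnitAddCircle) * fourier k ((n * b + t : ℝ) : UnitAddCircle))
      atTop (nhds (haarIntegral (fourier j) * haarIntegral (fourier k))) := by
    intro j k
    have hjk : haarIntegral (fourier j) * haarIntegral (fourier k)
        = if j = 0 ∧ k = 0 then 1 else 0 := by
      simp only [haarIntegral, LinearMap.coe_mk, AddHom.coe_mk, integral_fourier_haarAddCircle]
      split_ifs <;> simp_all
    rw [hjk]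
    split_ifs with h0
    · obtain ⟨rfl, rfl⟩ := h0
      refine tendsto_const_nhds.congr' ?_
      filter_upwards [eventually_gt_atTop 0] with N hN
      have : (N : ℂ) ≠ 0 := by exact_mod_cast hN.ne'
      simp [this]
    · set θ : ℝ := j * a + k * b with hθ
      have hz1 : Complex.exp (2 * Real.pi * Complex.I * θ) ≠ 1 := by
        intro h1
        obtain ⟨m, hm⟩ := Complex.exp_eq_one_iff.mp h1
        have hm' : (θ : ℂ) = m := by
          have h2 := Complex.two_pi_I_ne_zero
          apply mul_left_cancel₀ h2
          rw [hm, mul_comm]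
        exact h0 (hab j k m (by exact_mod_cast hm'))
      have hz : ‖Complex.exp (2 * Real.pi * Complex.I * θ)‖ = 1 := by
        rw [show (2 * Real.pi * Complex.I * θ : ℂ) = ((2 * Real.pi * θ : ℝ) : ℂ) * Complex.I by
          push_cast; ring]
        exact Complex.norm_exp_ofReal_mul_I _
      refine (tendsto_average_mul_pow
        (Complex.exp (2 * Real.pi * Complex.I * (j * s + k * t))) hz hz1).congr fun N => ?_
      congr 1
      refine Finset.sum_congr rfl fun n _ => ?_
      rw [fourier_coe_apply, fourier_coe_apply, ← Complex.exp_add, ← Complex.exp_nat_mul,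
        ← Complex.exp_add, hθ]
      congr 1
      push_cast
      ring
  have hfirst : ∀ k : ℤ, Tendsto (fun N : ℕ => (N : ℂ)⁻¹ * ∑ n ∈ Finset.Icc 1 N,
        f ((n * a + s : ℝ) : UnitAddCircle) * fourier k ((n * b + t : ℝ) : UnitAddCircle))
      atTop (nhds (haarIntegral f * haarIntegral (fourier k))) := by
    intro k
    have hI : ‖haarIntegral (fourier k)‖ ≤ 1 :=
      (norm_haarIntegral_le _).trans_eq (fourier_norm k)
    rw [mul_comm]
    refine tendsto_apply_of_span_dense
      (weightedAverage (fun n : ℕ => ((n * a + s : ℝ) : UnitAddCircle))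
        (fun n => fourier k ((n * b + t : ℝ) : UnitAddCircle)))
      (haarIntegral (fourier k) • haarIntegral) zero_le_one
      (norm_weightedAverage_le zero_le_one fun n =>
        ((fourier k).norm_coe_le_norm _).trans_eq (fourier_norm k))
      (fun v => ?_) span_fourier_closure_eq_top ?_ f
    · rw [LinearMap.smul_apply, smul_eq_mul, norm_mul]
      exact mul_le_mul hI (norm_haarIntegral_le v) (norm_nonneg _) zero_le_one
    · rintro _ ⟨j, rfl⟩
      rw [LinearMap.smul_apply, smul_eq_mul, mul_comm]
      exact hchar j k
  have hsecond := tendsto_apply_of_span_dense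
      (weightedAverage (fun n : ℕ => ((n * b + t : ℝ) : UnitAddCircle))
        (fun n => f ((n * a + s : ℝ) : UnitAddCircle)))
      (haarIntegral f • haarIntegral) (norm_nonneg f)
      (norm_weightedAverage_le (norm_nonneg f) fun n => f.norm_coe_le_norm _)
      (fun v => by
        rw [LinearMap.smul_apply, smul_eq_mul, norm_mul]
        exact mul_le_mul (norm_haarIntegral_le f) (norm_haarIntegral_le v)
          (norm_nonneg _) (norm_nonneg f))
      span_fourier_closure_eq_top
      (by
        rintro _ ⟨k, rfl⟩
        refine (hfirst k).congr fun N => ?_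
        simp only [weightedAverage, LinearMap.coe_mk, AddHom.coe_mk, mul_comm (f _)])
      g
  refine hsecond.congr fun N => ?_
  simp only [weightedAverage, LinearMap.coe_mk, AddHom.coe_mk, mul_comm (f _)]

/-- Weyl's theorem for products of functions of the fractional parts, each continuous on `[0, 1]`
with equal values at the endpoints. -/
theorem tendsto_average_mul_fract {a b : ℝ} (s t : ℝ)
    (hab : ∀ j k m : ℤ, (j : ℝ) * a + k * b = m → j = 0 ∧ k = 0) {P Q : ℝ → ℝ}
    (hP : ContinuousOn P (Set.Icc 0 1)) (hP1 : P 0 = P 1)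
    (hQ : ContinuousOn Q (Set.Icc 0 1)) (hQ1 : Q 0 = Q 1) :
    Tendsto (fun N : ℕ => (N : ℝ)⁻¹ * ∑ n ∈ Finset.Icc 1 N,
        P (Int.fract (n * a + s)) * Q (Int.fract (n * b + t)))
      atTop (nhds ((∫ x in (0:ℝ)..1, P x) * ∫ x in (0:ℝ)..1, Q x)) := by
  have key : ∀ R : ℝ → ℝ, ContinuousOn R (Set.Icc 0 1) → R 0 = R 1 →
      ∃ f : C(UnitAddCircle, ℂ), (∀ x : ℝ, f (x : UnitAddCircle) = (R (Int.fract x) : ℂ)) ∧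
        haarIntegral f = ((∫ x in (0:ℝ)..1, R x : ℝ) : ℂ) := by
    intro R hR hR1
    have hf : ∀ x : ℝ, AddCircle.liftIco 1 0 (fun y : ℝ => (R y : ℂ)) (x : UnitAddCircle)
        = (R (Int.fract x) : ℂ) := by
      intro x
      have hx : (x : UnitAddCircle) = ((Int.fract x : ℝ) : UnitAddCircle) := by
        rw [← sub_eq_zero, ← AddCircle.coe_sub, Int.self_sub_fract, AddCircle.coe_eq_zero_iff]
        exact ⟨⌊x⌋, by simp⟩
      rw [hx, AddCircle.liftIco_zero_coe_apply ⟨Int.fract_nonneg x, Int.fract_lt_one x⟩]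
    refine ⟨⟨AddCircle.liftIco 1 0 (fun y : ℝ => (R y : ℂ)),
      AddCircle.liftIco_zero_continuous (by rw [hR1])
        (Complex.continuous_ofReal.comp_continuousOn hR)⟩, hf, ?_⟩
    simp only [haarIntegral, LinearMap.coe_mk, AddHom.coe_mk, ContinuousMap.coe_mk]
    rw [AddCircle.integral_haarAddCircle, inv_one, one_smul,
      ← UnitAddCircle.intervalIntegral_preimage 0, zero_add, ← intervalIntegral.integral_ofReal]
    refine intervalIntegral.integral_congr_Ioo_of_le zero_le_one fun x hx => ?_
    rw [hf, Int.fract_eq_self.mpr ⟨hx.1.le, hx.2⟩]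
  obtain ⟨f, hf, hfI⟩ := key P hP hP1
  obtain ⟨g, hg, hgI⟩ := key Q hQ hQ1
  have h := tendsto_average_mul_continuousMap s t hab f g
  simp only [hf, hg, hfI, hgI] at h
  have hre := (Complex.continuous_re.tendsto _).comp h
  rw [← Complex.ofReal_mul, Complex.ofReal_re] at hre
  refine hre.congr fun N => ?_
  rw [Function.comp_apply, ← Complex.ofReal_re (_ * _)]
  push_cast
  rfl

/-- The mean of the square of the sawtooth `{x} - 1/2` is `1/12`. -/
theorem tendsto_average_sawtooth_sq {a b : ℝ}
    (hab : ∀ j k m : ℤ, (j : ℝ) * a + k * b = m → j = 0 ∧ k = 0) (s : ℝ) :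
    Tendsto (fun N : ℕ => (N : ℝ)⁻¹ * ∑ n ∈ Finset.Icc 1 N, (Int.fract (n * a + s) - 1/2) ^ 2)
      atTop (nhds (1/12)) := by
  have h := tendsto_average_mul_fract s 0 hab (P := fun x => (x - 1/2) ^ 2) (Q := fun _ => 1)
    (by fun_prop) (by norm_num) (by fun_prop) rfl
  have hI : ∫ x in (0:ℝ)..1, (x - 1/2) ^ 2 = 1/12 := by
    rw [intervalIntegral.integral_comp_sub_right (fun x => x ^ 2), integral_pow]
    norm_num
  simp only [hI, intervalIntegral.integral_const, sub_zero, one_smul, mul_one] at h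
  exact h

theorem integral_two_mul_sub_one_pow (K : ℕ) :
    ∫ x in (0:ℝ)..1, (2 * x - 1) ^ (2 * K) = 1 / (2 * K + 1) := by
  rw [intervalIntegral.integral_comp_mul_sub (fun x => x ^ (2 * K)) two_ne_zero, integral_pow]
  have h : (-1 : ℝ) ^ (2 * K + 1) = -1 := Odd.neg_one_pow ⟨K, rfl⟩
  norm_num [h]
  field_simp

theorem integral_damped_sawtooth (K : ℕ) :
    ∫ x in (0:ℝ)..1, (x - 1/2) * (1 - (2 * x - 1) ^ (2 * K)) = 0 := by
  have h := intervalIntegral.integral_comp_sub_left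
    (fun x : ℝ => (x - 1/2) * (1 - (2 * x - 1) ^ (2 * K))) (1 : ℝ) (a := 0) (b := 1)
  have hodd : ∀ x : ℝ, (1 - x - 1/2) * (1 - (2 * (1 - x) - 1) ^ (2 * K))
      = -((x - 1/2) * (1 - (2 * x - 1) ^ (2 * K))) := by
    intro x
    rw [show 2 * (1 - x) - 1 = -(2 * x - 1) by ring, Even.neg_pow (even_two_mul K)]
    ring
  simp only [hodd, intervalIntegral.integral_neg, sub_self, sub_zero] at h
  linarith

theorem abs_sawtooth_mul_sub_le {x y : ℝ} (hx0 : 0 ≤ x) (hx1 : x ≤ 1) (hy0 : 0 ≤ y) (hy1 : y ≤ 1)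
    (K : ℕ) :
    |(x - 1/2) * (y - 1/2)
      - ((x - 1/2) * (1 - (2 * x - 1) ^ (2 * K))) * ((y - 1/2) * (1 - (2 * y - 1) ^ (2 * K)))|
    ≤ (2 * x - 1) ^ (2 * K) + (2 * y - 1) ^ (2 * K) := by
  have hbd : ∀ z : ℝ, 0 ≤ z → z ≤ 1 → 0 ≤ (2 * z - 1) ^ (2 * K) ∧ (2 * z - 1) ^ (2 * K) ≤ 1 := by
    intro z h0 h1
    rw [pow_mul]
    exact ⟨by positivity, pow_le_one₀ (sq_nonneg _) (by nlinarith)⟩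
  obtain ⟨hp0, hp1⟩ := hbd x hx0 hx1
  obtain ⟨hq0, hq1⟩ := hbd y hy0 hy1
  generalize (2 * x - 1) ^ (2 * K) = p at *
  generalize (2 * y - 1) ^ (2 * K) = q at *
  have hxy : |(x - 1/2) * (y - 1/2)| ≤ 1 := by
    rw [abs_mul]
    exact mul_le_one₀ (by rw [abs_le]; constructor <;> linarith) (abs_nonneg _)
      (by rw [abs_le]; constructor <;> linarith)
  rw [show (x - 1/2) * (y - 1/2) - ((x - 1/2) * (1 - p)) * ((y - 1/2) * (1 - q))
    = (x - 1/2) * (y - 1/2) * (p + q * (1 - p)) by ring, abs_mul,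
    abs_of_nonneg (by nlinarith : 0 ≤ p + q * (1 - p))]
  nlinarith [mul_nonneg hp0 hq0, mul_nonneg hq0 (sub_nonneg.mpr hp1)]

/-- The sawtooths of two independent rotations are uncorrelated. -/
theorem tendsto_average_sawtooth_mul {a b : ℝ}
    (hab : ∀ j k m : ℤ, (j : ℝ) * a + k * b = m → j = 0 ∧ k = 0) (s t : ℝ) :
    Tendsto (fun N : ℕ => (N : ℝ)⁻¹ * ∑ n ∈ Finset.Icc 1 N,
        (Int.fract (n * a + s) - 1/2) * (Int.fract (n * b + t) - 1/2)) atTop (nhds 0) := by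
  rw [Metric.tendsto_atTop]
  intro ε hε
  obtain ⟨K, hK⟩ := exists_nat_gt (4 / ε)
  have hKε : 2 * (1 / (2 * (K : ℝ) + 1)) < ε / 2 := by
    rw [div_lt_iff₀ hε] at hK
    rw [mul_one_div, div_lt_iff₀ (by positivity)]
    nlinarith
  set G : ℝ → ℝ := fun x => (2 * x - 1) ^ (2 * K) with hG
  set R : ℝ → ℝ := fun x => (x - 1/2) * (1 - G x) with hR
  have hG1 : G 0 = G 1 := by norm_num [hG, pow_mul]
  have hR1 : R 0 = R 1 := by norm_num [hR, hG, pow_mul]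
  have hmain := tendsto_average_mul_fract s t hab (P := R) (Q := R)
    (by fun_prop) hR1 (by fun_prop) hR1
  have hGx := tendsto_average_mul_fract s t hab (P := G) (Q := fun _ => 1)
    (by fun_prop) hG1 (by fun_prop) rfl
  have hGy := tendsto_average_mul_fract s t hab (P := fun _ => 1) (Q := G)
    (by fun_prop) rfl (by fun_prop) hG1
  rw [integral_damped_sawtooth K, mul_zero] at hmain
  have hGint : ∫ x in (0:ℝ)..1, G x = 1 / (2 * K + 1) := integral_two_mul_sub_one_pow K
  have hGsum := hGx.add hGy
  simp only [hGint, intervalIntegral.integral_const, sub_zero, one_smul, mul_one, one_mul,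
    ← two_mul] at hGsum
  obtain ⟨N₁, hN₁⟩ := Metric.tendsto_atTop.mp hmain (ε / 2) (by positivity)
  obtain ⟨N₂, hN₂⟩ := eventually_atTop.mp (hGsum.eventually_lt_const hKε)
  refine ⟨max N₁ N₂, fun N hN => ?_⟩
  have h1 := hN₁ N (le_of_max_le_left hN)
  have h2 := hN₂ N (le_of_max_le_right hN)
  rw [Real.dist_0_eq_abs] at h1 ⊢
  have hdiff : |(N : ℝ)⁻¹ * ∑ n ∈ Finset.Icc 1 N,
        (Int.fract (n * a + s) - 1/2) * (Int.fract (n * b + t) - 1/2)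
      - (N : ℝ)⁻¹ * ∑ n ∈ Finset.Icc 1 N, R (Int.fract (n * a + s)) * R (Int.fract (n * b + t))|
      ≤ (N : ℝ)⁻¹ * ∑ n ∈ Finset.Icc 1 N, G (Int.fract (n * a + s))
        + (N : ℝ)⁻¹ * ∑ n ∈ Finset.Icc 1 N, G (Int.fract (n * b + t)) := by
    rw [← mul_sub, ← mul_add, abs_mul, abs_of_nonneg (by positivity : 0 ≤ (N : ℝ)⁻¹),
      ← Finset.sum_sub_distrib, ← Finset.sum_add_distrib]
    refine mul_le_mul_of_nonneg_left ((Finset.abs_sum_le_sum_abs _ _).trans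
      (Finset.sum_le_sum fun n _ => ?_)) (by positivity)
    exact abs_sawtooth_mul_sub_le (Int.fract_nonneg _) (Int.fract_lt_one _).le
      (Int.fract_nonneg _) (Int.fract_lt_one _).le K
  have h3 := abs_sub_abs_le_abs_sub
    ((N : ℝ)⁻¹ * ∑ n ∈ Finset.Icc 1 N,
        (Int.fract (n * a + s) - 1/2) * (Int.fract (n * b + t) - 1/2))
    ((N : ℝ)⁻¹ * ∑ n ∈ Finset.Icc 1 N, R (Int.fract (n * a + s)) * R (Int.fract (n * b + t)))
  linarith

theorem wCount_zero {S : Set ℕ} (hS : 0 ∉ S) : wCount S 0 = 0 := by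
  have : S ∩ Set.Iic 0 = ∅ := by
    ext k
    simp only [Set.mem_inter_iff, Set.mem_Iic, Nat.le_zero, Set.mem_empty_iff_false, iff_false]
    rintro ⟨hk, rfl⟩
    exact hS hk
  simp [wCount, this]

open Classical in
theorem wCount_succ (S : Set ℕ) (m : ℕ) :
    wCount S (m + 1) = wCount S m + if m + 1 ∈ S then 1 else 0 := by
  have hfin : (S ∩ Set.Iic m).Finite := (Set.finite_Iic m).inter_of_right S
  unfold wCount
  split_ifs with h
  · rw [← Set.ncard_insert_of_notMem (a := m + 1) (by simp) hfin]
    congr 1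
    ext k
    simp only [Set.mem_inter_iff, Set.mem_Iic, Set.mem_insert_iff]
    grind
  · rw [add_zero]
    congr 1
    ext k
    simp only [Set.mem_inter_iff, Set.mem_Iic]
    grind

theorem wSet_eq_WtA {d : ℝ} (hd : 0 < d) (hd1 : d < 1) : wSet d = WtA d := by
  ext m
  simp only [wSet, WtA, wTerm, fpart, Set.mem_ofPred_eq]
  constructor
  · rintro ⟨n, hn, hm⟩
    have hn' : (1 : ℝ) ≤ n := by exact_mod_cast hn
    have hm0 : m ≠ 0 := by
      rw [hm]
      exact (Nat.ceil_pos.mpr (div_pos (by linarith) hd)).ne'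
    obtain ⟨h1, h2⟩ := (Nat.ceil_eq_iff hm0).mp hm.symm
    rw [lt_div_iff₀ hd, Nat.cast_sub (by omega)] at h1
    rw [div_le_iff₀ hd] at h2
    push_cast at h1
    have hfl : ⌊(m : ℝ) * d + 1/2⌋ = n := by
      rw [Int.floor_eq_iff]
      push_cast
      constructor <;> linarith
    refine ⟨by omega, ?_⟩
    rw [Int.fract, hfl]
    push_cast
    linarith
  · rintro ⟨hm, hlt⟩
    have hm' : (1 : ℝ) ≤ m := by exact_mod_cast hm
    have hfr := Int.fract_nonneg ((m : ℝ) * d + 1/2)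
    rw [Int.fract] at hlt hfr
    have hpos : 0 < ⌊(m : ℝ) * d + 1/2⌋ := by
      have : (0 : ℝ) < ⌊(m : ℝ) * d + 1/2⌋ := by nlinarith
      exact_mod_cast this
    obtain ⟨n, hn⟩ := Int.eq_ofNat_of_zero_le hpos.le
    rw [hn] at hlt hfr hpos
    push_cast at hlt hfr hpos
    refine ⟨n, by omega, ((Nat.ceil_eq_iff (by omega)).mpr ⟨?_, ?_⟩).symm⟩
    · rw [lt_div_iff₀ hd, Nat.cast_sub hm]
      push_cast
      linarith
    · rw [div_le_iff₀ hd]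
      linarith

/-- One step of a rotation by `d`: the fractional part either grows by `d`, or it wraps around and
the floor grows by one. -/
theorem fract_floor_add_cases {d : ℝ} (hd : 0 < d) (hd1 : d < 1) (x : ℝ) :
    (Int.fract (x + d) = Int.fract x + d ∧ ⌊x + d⌋ = ⌊x⌋) ∨
    (Int.fract (x + d) = Int.fract x + d - 1 ∧ ⌊x + d⌋ = ⌊x⌋ + 1) := by
  have h0 := Int.fract_nonneg x
  have h1 := Int.fract_lt_one x
  have hx := Int.floor_add_fract x
  rcases lt_or_ge (Int.fract x + d) 1 with h | h
  · left
    have : ⌊x + d⌋ = ⌊x⌋ := by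
      rw [Int.floor_eq_iff]
      constructor <;> linarith
    refine ⟨?_, this⟩
    rw [Int.fract, this]
    linarith
  · right
    have : ⌊x + d⌋ = ⌊x⌋ + 1 := by
      rw [Int.floor_eq_iff]
      push_cast
      constructor <;> linarith
    refine ⟨?_, this⟩
    rw [Int.fract, this]
    push_cast
    linarith

theorem fpart_succ_cases {d : ℝ} (hd : 0 < d) (hd1 : d < 1) (n : ℕ) :
    (fpart d (n + 1) = fpart d n + d ∧
      ⌊((n + 1 : ℕ) : ℝ) * d + 1/2⌋ = ⌊(n : ℝ) * d + 1/2⌋) ∨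
    (fpart d (n + 1) = fpart d n + d - 1 ∧
      ⌊((n + 1 : ℕ) : ℝ) * d + 1/2⌋ = ⌊(n : ℝ) * d + 1/2⌋ + 1) := by
  have h := fract_floor_add_cases hd hd1 ((n : ℝ) * d + 1/2)
  rw [show (n : ℝ) * d + 1/2 + d = ((n + 1 : ℕ) : ℝ) * d + 1/2 by push_cast; ring] at h
  exact h

theorem wCount_WtA {d : ℝ} (hd : 0 < d) (hd1 : d < 1) (n : ℕ) :
    (wCount (WtA d) n : ℤ) = ⌊(n : ℝ) * d + 1/2⌋ := by
  classical
  induction n with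
  | zero =>
    rw [wCount_zero (by simp [WtA])]
    norm_num
  | succ n ih =>
    rw [wCount_succ]
    push_cast
    rw [ih]
    have h0 : 0 ≤ fpart d n := Int.fract_nonneg _
    have h1 : fpart d n < 1 := Int.fract_lt_one _
    have hmem : n + 1 ∈ WtA d ↔ fpart d (n + 1) < d := by simp [WtA]
    rw [hmem]
    rcases fpart_succ_cases hd hd1 n with ⟨hf, hfl⟩ | ⟨hf, hfl⟩
    · rw [if_neg (by linarith)]
      push_cast at hfl
      rw [hfl, add_zero]
    · rw [if_pos (by linarith)]
      push_cast at hfl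
      rw [hfl]

/-- An orbit point `{n d + 1/2}` of an irrational rotation avoids `0`. -/
theorem fpart_ne_zero {d : ℝ} (hd : Irrational d) (n : ℕ) : fpart d n ≠ 0 := by
  intro h
  have h2 : (n : ℝ) * d + 1/2 = ⌊(n : ℝ) * d + 1/2⌋ := by
    have := Int.floor_add_fract ((n : ℝ) * d + 1/2)
    rw [fpart] at h
    linarith
  generalize ⌊(n : ℝ) * d + 1/2⌋ = m at h2
  rcases Nat.eq_zero_or_pos n with rfl | hn
  · have h3 : (1 : ℝ) = 2 * m := by push_cast at h2; linarith
    have h4 : (1 : ℤ) = 2 * m := by exact_mod_cast h3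
    omega
  · apply hd
    have hn' : (n : ℝ) ≠ 0 := by exact_mod_cast hn.ne'
    refine ⟨((m : ℚ) - 1/2) / n, ?_⟩
    push_cast
    field_simp
    linarith

/-- An orbit point `{n d + 1/2}` of an irrational rotation avoids `d / 2`. -/
theorem fpart_ne_half {d : ℝ} (hd : Irrational d) (n : ℕ) : fpart d n ≠ d / 2 := by
  intro h
  have h2 : ((n : ℝ) - 1/2) * d = ⌊(n : ℝ) * d + 1/2⌋ - 1/2 := by
    have := Int.floor_add_fract ((n : ℝ) * d + 1/2)
    rw [fpart] at h
    linarith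
  generalize ⌊(n : ℝ) * d + 1/2⌋ = m at h2
  have hn : (n : ℝ) - 1/2 ≠ 0 := by
    intro h0
    have h3 : 2 * (n : ℝ) = 1 := by linarith
    have h4 : 2 * n = 1 := by exact_mod_cast h3
    omega
  apply hd
  refine ⟨((m : ℚ) - 1/2) / (n - 1/2), ?_⟩
  push_cast
  rw [div_eq_iff hn]
  linarith

open Classical in
/-- The counting error of `WtB` at `n`: a conflict at `n + 1` resolved early contributes `1`, one at
`n` resolved late contributes `-1`. -/
noncomputable def errB (α β : ℝ) (n : ℕ) : ℤ :=
  (if 1 - α < fpart α n ∧ 1 - β/2 < fpart β n then 1 else 0)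
    - (if fpart α n < α ∧ fpart β n < β/2 then 1 else 0)

theorem wCount_WtB {α β : ℝ} (hα : 0 < α) (hβ : 0 < β) (hαi : Irrational α) (hβi : Irrational β)
    (hα2 : α < 1/2) (hβ2 : β < 1/2) (n : ℕ) :
    (wCount (WtB α β) n : ℤ) = ⌊(n : ℝ) * β + 1/2⌋ + errB α β n := by
  classical
  induction n with
  | zero =>
    have h : ∀ d, fpart d 0 = 1/2 := by
      intro d
      rw [fpart, Nat.cast_zero, zero_mul, zero_add, Int.fract_eq_self]
      norm_num
    rw [wCount_zero (by simp [WtB]), errB, h, h, if_neg (by rintro ⟨h, -⟩; linarith),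
      if_neg (by rintro ⟨h, -⟩; linarith)]
    norm_num
  | succ n ih =>
    rw [wCount_succ, Nat.cast_add, ih]
    have hu0 : 0 < fpart α n := lt_of_le_of_ne (Int.fract_nonneg _) (fpart_ne_zero hαi n).symm
    have hv0 : 0 < fpart β n := lt_of_le_of_ne (Int.fract_nonneg _) (fpart_ne_zero hβi n).symm
    have hu1 : fpart α n < 1 := Int.fract_lt_one _
    have hv1 : fpart β n < 1 := Int.fract_lt_one _
    have hu0' : 0 < fpart α (n + 1) :=
      lt_of_le_of_ne (Int.fract_nonneg _) (fpart_ne_zero hαi _).symm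
    have hv0' : 0 < fpart β (n + 1) :=
      lt_of_le_of_ne (Int.fract_nonneg _) (fpart_ne_zero hβi _).symm
    have hu1' : fpart α (n + 1) < 1 := Int.fract_lt_one _
    have hv1' : fpart β (n + 1) < 1 := Int.fract_lt_one _
    have hvh := fpart_ne_half hβi (n + 1)
    have hu := fpart_succ_cases hα (by linarith) n
    have hv := fpart_succ_cases hβ (by linarith) n
    have hmem : n + 1 ∈ WtB α β ↔ (α < fpart α (n + 1) ∧ fpart β (n + 1) < β) ∨
        (1 - α < fpart α (n + 1) ∧ 1 - β/2 < fpart β (n + 1)) ∨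
        (α < fpart α (n + 1) ∧ fpart α (n + 1) < 2*α ∧ β < fpart β (n + 1) ∧
          fpart β (n + 1) < 3*β/2) := by
      simp [WtB]
    simp only [errB]
    rcases hu with ⟨hu, -⟩ | ⟨hu, -⟩ <;> rcases hv with ⟨hv, hF⟩ | ⟨hv, hF⟩ <;> rw [hF] <;>
      grind

open Classical in
theorem wCount_WtC {α β : ℝ} (hα2 : α < 1/2) (n : ℕ) :
    (wCount (WtC α β) n : ℤ) = n - wCount (WtA α) n - wCount (WtB α β) n := by
  induction n with
  | zero =>
    rw [wCount_zero (by simp [WtC]), wCount_zero (by simp [WtA]), wCount_zero (by simp [WtB])]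
    simp
  | succ n ih =>
    have hC : n + 1 ∈ WtC α β ↔ ¬(n + 1 ∈ WtA α ∨ n + 1 ∈ WtB α β) := by simp [WtC]
    have hdisj : ¬(n + 1 ∈ WtA α ∧ n + 1 ∈ WtB α β) := by
      rintro ⟨⟨-, hA⟩, -, hB | hB | hB⟩ <;> linarith [hB.1]
    rw [wCount_succ, wCount_succ, wCount_succ]
    push_cast
    rw [ih]
    by_cases hA : n + 1 ∈ WtA α <;> by_cases hB : n + 1 ∈ WtB α β <;>
      simp only [hA, hB, hC, and_self, or_self, or_true, true_or, not_true, not_false_eq_true,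
        if_true, if_false] at hdisj ⊢ <;> ring

/-- The two squared counting errors add up to the square of the sum of three sawtooths. -/
theorem sq_error_add_sq_error {α β γ : ℝ}
    (hα : 0 < α) (hβ : 0 < β) (hγ : 0 < γ) (hαi : Irrational α) (hβi : Irrational β)
    (hsum : α + β + γ = 1) (hβhalf : β < 1/2) (hαγ : α < γ) (n : ℕ) :
    ((wCount (WtB α β) n : ℝ) - (wCount (wSet β) n : ℝ))^2 +
      ((wCount (WtC α β) n : ℝ) - (wCount (wSet γ) n : ℝ))^2
    = ((fpart α n - 1/2) + (fpart β n - 1/2) + (fpart γ n - 1/2))^2 := by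
  have hα2 : α < 1/2 := by linarith
  rw [wSet_eq_WtA hβ (by linarith), wSet_eq_WtA hγ (by linarith)]
  have hA := wCount_WtA hα (by linarith) n
  have hB := wCount_WtB hα hβ hαi hβi hα2 hβhalf n
  have hC := wCount_WtC (β := β) hα2 n
  have hB' := wCount_WtA hβ (by linarith) n
  have hC' := wCount_WtA hγ (by linarith) n
  have hu := Int.floor_add_fract ((n : ℝ) * α + 1/2)
  have hv := Int.floor_add_fract ((n : ℝ) * β + 1/2)
  have hw := Int.floor_add_fract ((n : ℝ) * γ + 1/2)
  have hw0 : 0 ≤ fpart γ n := Int.fract_nonneg _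
  have hw1 : fpart γ n < 1 := Int.fract_lt_one _
  have hu0 : 0 ≤ fpart α n := Int.fract_nonneg _
  have hu1 : fpart α n < 1 := Int.fract_lt_one _
  have hv0 : 0 ≤ fpart β n := Int.fract_nonneg _
  have hv1 : fpart β n < 1 := Int.fract_lt_one _
  change _ + fpart α n = _ at hu
  change _ + fpart β n = _ at hv
  change _ + fpart γ n = _ at hw
  obtain ⟨E, hE⟩ : ∃ E : ℤ, E = n - ⌊(n : ℝ) * α + 1/2⌋ - ⌊(n : ℝ) * β + 1/2⌋
      - ⌊(n : ℝ) * γ + 1/2⌋ := ⟨_, rfl⟩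
  have hER : (E : ℝ) = (fpart α n - 1/2) + (fpart β n - 1/2) + (fpart γ n - 1/2) := by
    rw [hE]
    push_cast
    have : (n : ℝ) = n * α + n * β + n * γ := by rw [← mul_add, ← mul_add, hsum, mul_one]
    linarith
  have hDB : (wCount (WtB α β) n : ℤ) - wCount (WtA β) n = errB α β n := by
    rw [hB, hB']; ring
  have hDC : (wCount (WtC α β) n : ℤ) - wCount (WtA γ) n = E - errB α β n := by
    rw [hC, hC', hA, hB, hE]; ring
  have hkey : errB α β n ^ 2 + (E - errB α β n) ^ 2 = E ^ 2 := by
    have hE1 : 1 - α < fpart α n ∧ 1 - β/2 < fpart β n → E = 1 := by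
      rintro ⟨h1, h2⟩
      have h3 : (0 : ℝ) < E := by linarith
      have h4 : (E : ℝ) < 2 := by linarith
      have h5 : 0 < E := by exact_mod_cast h3
      have h6 : E < 2 := by exact_mod_cast h4
      omega
    have hE2 : fpart α n < α ∧ fpart β n < β/2 → E = -1 := by
      rintro ⟨h1, h2⟩
      have h3 : (-2 : ℝ) < E := by linarith
      have h4 : (E : ℝ) < 0 := by linarith
      have h5 : -2 < E := by exact_mod_cast h3
      have h6 : E < 0 := by exact_mod_cast h4
      omega
    unfold errB
    split_ifs with h1 h2 h2
    · linarith [hE1 h1, hE2 h2]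
    · rw [hE1 h1]; norm_num
    · rw [hE2 h2]; norm_num
    · ring
  rw [← hER]
  exact_mod_cast hDB ▸ hDC ▸ hkey

theorem int_relation_eq_zero {α β : ℝ} (hindep : LinearIndependent ℚ ![(1 : ℝ), α, β])
    (l j k : ℤ) (h : (l : ℝ) + j * α + k * β = 0) : l = 0 ∧ j = 0 ∧ k = 0 := by
  rw [Fintype.linearIndependent_iff] at hindep
  have h' := hindep ![(l : ℚ), j, k] (by
    simpa [Fin.sum_univ_three, Rat.smul_def] using h)
  have h0 := h' 0
  have h1 := h' 1
  have h2 := h' 2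
  simp at h0 h1 h2
  exact ⟨h0, h1, h2⟩

/-- The mean-square counting-function error `Ω` equals `1/4`. -/
theorem mean_square_counting_error (α β γ : ℝ)
    (hα : 0 < α) (hβ : 0 < β) (hγ : 0 < γ)
    (hαi : Irrational α) (hβi : Irrational β) (hγi : Irrational γ)
    (hsum : α + β + γ = 1) (hβhalf : β < 1/2) (hαγ : α < γ)
    (hindep : LinearIndependent ℚ ![(1 : ℝ), α, β]) :
    Tendsto (fun N : ℕ =>
      (1 / (N : ℝ)) * ∑ n ∈ Finset.Icc 1 N,
        (((wCount (WtB α β) n : ℝ) - (wCount (wSet β) n : ℝ))^2 +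
         ((wCount (WtC α β) n : ℝ) - (wCount (wSet γ) n : ℝ))^2))
      atTop (nhds (1/4)) := by
  have hαβ : ∀ j k m : ℤ, (j : ℝ) * α + k * β = m → j = 0 ∧ k = 0 := by
    intro j k m h
    have := int_relation_eq_zero hindep (-m) j k (by push_cast; linarith)
    exact this.2
  have hγeq : γ = 1 - α - β := by linarith
  have hβγ : ∀ j k m : ℤ, (j : ℝ) * β + k * γ = m → j = 0 ∧ k = 0 := by
    intro j k m h
    have := int_relation_eq_zero hindep (k - m) (-k) (j - k) (by
      rw [hγeq] at h; push_cast; linarith)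
    omega
  have hγα : ∀ j k m : ℤ, (j : ℝ) * γ + k * α = m → j = 0 ∧ k = 0 := by
    intro j k m h
    have := int_relation_eq_zero hindep (j - m) (k - j) (-j) (by
      rw [hγeq] at h; push_cast; linarith)
    omega
  have hsq := ((tendsto_average_sawtooth_sq hαβ (1/2)).add
    (tendsto_average_sawtooth_sq hβγ (1/2))).add (tendsto_average_sawtooth_sq hγα (1/2))
  have hmul := ((tendsto_average_sawtooth_mul hαβ (1/2) (1/2)).add
    (tendsto_average_sawtooth_mul hβγ (1/2) (1/2))).add
    (tendsto_average_sawtooth_mul hγα (1/2) (1/2))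
  have h := hsq.add (hmul.const_mul 2)
  rw [show (1/12 + 1/12 + 1/12 + 2 * (0 + 0 + 0) : ℝ) = 1/4 by norm_num] at h
  refine h.congr fun N => ?_
  rw [one_div (N : ℝ), ← mul_add, ← mul_add, ← mul_add, ← mul_add, mul_left_comm, ← mul_add]
  congr 1
  rw [← Finset.sum_add_distrib, ← Finset.sum_add_distrib, ← Finset.sum_add_distrib,
    ← Finset.sum_add_distrib, Finset.mul_sum, ← Finset.sum_add_distrib]
  refine Finset.sum_congr rfl fun n _ => ?_
  rw [sq_error_add_sq_error hα hβ hγ hαi hβi hsum hβhalf hαγ n]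
  simp only [fpart]
  ring
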